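/- arXiv:2105.01360 — 5 statements merged into one kernel-verified Lean document; each statement's English description precedes it below -/
import Mathlib

section
/- Let G₀, G₁ : ℝ → ℝ be differentiable functions with G₁(t) ≠ 0 for all t ∈ ℝ, and let f : ℝ² → ℝ² be the map f(x,y) = (x·G₁(ȳ) + G₀(ȳ), ȳ), where ȳ = (y − G₀(x))/G₁(x). Then f is differentiable and the determinant of its Jacobian matrix at (x,y) equals G₁(ȳ)/G₁(x), where ȳ = (y − G₀(x))/G₁(x). In particular this determinant never vanishes. -/
/-- The explicit cross-form map for `F(x,y) = x·G₁(y) + G₀(y)`: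
`f(x,y) = (x·G₁(ȳ) + G₀(ȳ), ȳ)` where `ȳ = (y - G₀(x))/G₁(x)`. -/
noncomputable def crossExplicit (G₀ G₁ : ℝ → ℝ) : ℝ × ℝ → ℝ × ℝ := fun p =>
  let yb := (p.2 - G₀ p.1) / G₁ p.1
  (p.1 * G₁ yb + G₀ yb, yb)

theorem LinearMap.det_prod_self {R : Type*} [CommRing R] (L : R × R →ₗ[R] R × R) :
    LinearMap.det L = (L (1, 0)).1 * (L (0, 1)).2 - (L (0, 1)).1 * (L (1, 0)).2 := by
  rw [← LinearMap.det_toMatrix (Module.Basis.finTwoProd R), Matrix.det_fin_two]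
  simp [LinearMap.toMatrix_apply]

theorem hasFDerivAt_sub_div_fst {G₀ G₁ : ℝ → ℝ} {p : ℝ × ℝ}
    (h₀ : DifferentiableAt ℝ G₀ p.1) (h₁ : DifferentiableAt ℝ G₁ p.1) (hp : G₁ p.1 ≠ 0) :
    ∃ L : ℝ × ℝ →L[ℝ] ℝ, HasFDerivAt (fun q : ℝ × ℝ => (q.2 - G₀ q.1) / G₁ q.1) L p ∧
      L (0, 1) = (G₁ p.1)⁻¹ := by
  have hfst : HasFDerivAt Prod.fst (ContinuousLinearMap.fst ℝ ℝ ℝ) p := hasFDerivAt_fst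
  have h₀' := h₀.hasDerivAt.comp_hasFDerivAt p hfst
  have h₁' := (h₁.hasDerivAt.fun_inv hp).comp_hasFDerivAt p hfst
  exact ⟨_, (hasFDerivAt_snd.sub h₀').mul h₁', by simp⟩

theorem exists_hasFDerivAt_crossExplicit {G₀ G₁ : ℝ → ℝ}
    (h₀ : Differentiable ℝ G₀) (h₁ : Differentiable ℝ G₁) {p : ℝ × ℝ} (hp : G₁ p.1 ≠ 0) :
    ∃ L : ℝ × ℝ →L[ℝ] ℝ × ℝ, HasFDerivAt (crossExplicit G₀ G₁) L p ∧
      LinearMap.det (L : (ℝ × ℝ) →ₗ[ℝ] ℝ × ℝ) =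
        G₁ ((p.2 - G₀ p.1) / G₁ p.1) / G₁ p.1 := by
  obtain ⟨L, hL, hL₁⟩ := hasFDerivAt_sub_div_fst (h₀ p.1) (h₁ p.1) hp
  have h₀' := (h₀ ((p.2 - G₀ p.1) / G₁ p.1)).hasDerivAt.comp_hasFDerivAt p hL
  have h₁' := (h₁ ((p.2 - G₀ p.1) / G₁ p.1)).hasDerivAt.comp_hasFDerivAt p hL
  refine ⟨_, ((hasFDerivAt_fst.mul h₁').add h₀').prodMk hL, ?_⟩
  rw [LinearMap.det_prod_self]
  simp [hL₁]
  ring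


/-- if `G₀, G₁` are differentiable and `G₁` never vanishes, then the
explicit cross-form map `f` is differentiable, the determinant of its Jacobian
matrix at `(x,y)` equals `G₁(ȳ)/G₁(x)` with `ȳ = (y - G₀(x))/G₁(x)`, and in
particular this determinant never vanishes. -/
theorem crossExplicit_jacobian (G₀ G₁ : ℝ → ℝ)
    (h₀ : Differentiable ℝ G₀) (h₁ : Differentiable ℝ G₁)
    (hG₁ : ∀ t : ℝ, G₁ t ≠ 0) :
    Differentiable ℝ (crossExplicit G₀ G₁) ∧
    ∀ p : ℝ × ℝ,
      LinearMap.det (↑(fderiv ℝ (crossExplicit G₀ G₁) p) : (ℝ × ℝ) →ₗ[ℝ] ℝ × ℝ) =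
        G₁ ((p.2 - G₀ p.1) / G₁ p.1) / G₁ p.1 ∧
      LinearMap.det (↑(fderiv ℝ (crossExplicit G₀ G₁) p) : (ℝ × ℝ) →ₗ[ℝ] ℝ × ℝ) ≠ 0 := by
  choose L hL hdet using fun p : ℝ × ℝ => exists_hasFDerivAt_crossExplicit h₀ h₁ (hG₁ p.1)
  refine ⟨fun p => (hL p).differentiableAt, fun p => ?_⟩
  rw [(hL p).fderiv, hdet p]
  exact ⟨rfl, div_ne_zero (hG₁ _) (hG₁ _)⟩
end

section
/- Fix d ∈ {−1, 1}, M₁, M₂, ε ∈ ℝ, and let P(t) = M₁ + M₂ t + d t³. Define the perturbed map f on the set where 1 − εx ≠ 0 by f(x,y) = (x̄, ȳ), with ȳ = (P(x) − y)/(1 − εx) and x̄ = P(ȳ) − x + ε x ȳ. Then f is reversible with respect to h(x,y) = (y,x) in the following sense: if (x̄, ȳ) = f(x,y) with 1 − εx ≠ 0, and additionally 1 − εȳ ≠ 0, then f(ȳ, x̄) = (y, x). -/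
/-- The cubic polynomial `P(t) = M₁ + M₂·t + d·t³`. -/
def cubicP (d M₁ M₂ : ℝ) : ℝ → ℝ := fun t => M₁ + M₂ * t + d * t ^ 3

/-- The involution `h(x,y) = (y,x)`. -/
def swapInvolution : ℝ × ℝ → ℝ × ℝ := fun p => (p.2, p.1)

/-- The explicit form of the reversible non-conservative perturbation
`H̃₃^{2,d}(ε)` of the second iterate of the inverse cubic Hénon map:
`f(x,y) = (x̄, ȳ)` with `ȳ = (P(x) - y)/(1 - εx)` and
`x̄ = P(ȳ) - x + ε·x·ȳ`. -/
noncomputable def perturbedH2 (d M₁ M₂ ε : ℝ) : ℝ × ℝ → ℝ × ℝ := fun p =>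
  let yb := (cubicP d M₁ M₂ p.1 - p.2) / (1 - ε * p.1)
  (cubicP d M₁ M₂ yb - p.1 + ε * p.1 * yb, yb)

/-- reversibility of the perturbed map with respect to
`h(x,y) = (y,x)`: if `(x̄,ȳ) = f(x,y)` with `1 - εx ≠ 0` and `1 - εȳ ≠ 0`,
then `f(ȳ,x̄) = (y,x)`. -/
theorem perturbedH2_reversible (d M₁ M₂ ε x y : ℝ) (hd : d = -1 ∨ d = 1)
    (hx : 1 - ε * x ≠ 0)
    (hyb : 1 - ε * ((cubicP d M₁ M₂ x - y) / (1 - ε * x)) ≠ 0) :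
    perturbedH2 d M₁ M₂ ε (swapInvolution (perturbedH2 d M₁ M₂ ε (x, y))) = (y, x) := by
  have hy : (cubicP d M₁ M₂ x - y) / (1 - ε * x) * (1 - ε * x) = cubicP d M₁ M₂ x - y :=
    div_mul_cancel₀ _ hx
  simp only [perturbedH2, swapInvolution]
  set b := (cubicP d M₁ M₂ x - y) / (1 - ε * x)
  have hx' : (cubicP d M₁ M₂ b - (cubicP d M₁ M₂ b - x + ε * x * b)) / (1 - ε * b) = x := by
    rw [div_eq_iff hyb]
    ring
  rw [hx']
  ext
  · linear_combination -hy
  · rfl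
end

section
/- Fix d ∈ {−1, 1}, M₁, M₂, ε ∈ ℝ, and let P(t) = M₁ + M₂ t + d t³. Let f be the map f(x,y) = (x̄, ȳ) with ȳ = (P(x) − y)/(1 − εx) and x̄ = P(ȳ) − x + ε x ȳ, defined where 1 − εx ≠ 0. Then at every point (x,y) with 1 − εx ≠ 0, f is differentiable and the determinant of its Jacobian matrix equals (1 − εȳ)/(1 − εx), where ȳ = (P(x) − y)/(1 − εx). In particular, for ε ≠ 0 this determinant is not identically equal to 1, so the perturbed map is non-conservative. -/
open ContinuousLinearMap in
/-- The determinant of the endomorphism `(x, y) ↦ (a x + b y, c x + e y)` of the plane. -/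
lemma det_prod_smul_fst_add_smul_snd (a b c e : ℝ) :
    LinearMap.det (↑((a • fst ℝ ℝ ℝ + b • snd ℝ ℝ ℝ).prod (c • fst ℝ ℝ ℝ + e • snd ℝ ℝ ℝ)) :
      (ℝ × ℝ) →ₗ[ℝ] ℝ × ℝ) = a * e - b * c := by
  rw [← LinearMap.det_toMatrix (Module.Basis.finTwoProd ℝ), Matrix.det_fin_two]
  simp [LinearMap.toMatrix_apply]

lemma hasDerivAt_cubicP (d M₁ M₂ t : ℝ) :
    HasDerivAt (cubicP d M₁ M₂) (M₂ + d * (3 * t ^ 2)) t := by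
  have h := (((hasDerivAt_id t).const_mul M₂).const_add M₁).add
    ((hasDerivAt_pow 3 t).const_mul d)
  simpa using! h

open ContinuousLinearMap in
lemma hasFDerivAt_perturbedH2 (d M₁ M₂ ε : ℝ) (p : ℝ × ℝ) (hp : 1 - ε * p.1 ≠ 0) :
    let yb := (cubicP d M₁ M₂ p.1 - p.2) / (1 - ε * p.1)
    let a := (M₂ + d * (3 * p.1 ^ 2) + ε * yb) / (1 - ε * p.1)
    let b := -1 / (1 - ε * p.1)
    let k := M₂ + d * (3 * yb ^ 2) + ε * p.1
    HasFDerivAt (perturbedH2 d M₁ M₂ ε)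
      (((k * a - 1 + ε * yb) • fst ℝ ℝ ℝ + (k * b) • snd ℝ ℝ ℝ).prod
        (a • fst ℝ ℝ ℝ + b • snd ℝ ℝ ℝ)) p := by
  intro yb a b k
  have hx : HasFDerivAt (fun q : ℝ × ℝ => q.1) (fst ℝ ℝ ℝ) p := hasFDerivAt_fst
  have hy : HasFDerivAt (fun q : ℝ × ℝ => q.2) (snd ℝ ℝ ℝ) p := hasFDerivAt_snd
  have hyb : HasFDerivAt (fun q : ℝ × ℝ => (cubicP d M₁ M₂ q.1 - q.2) / (1 - ε * q.1))
      (a • fst ℝ ℝ ℝ + b • snd ℝ ℝ ℝ) p := by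
    have hP := (hasDerivAt_cubicP d M₁ M₂ p.1).comp_hasFDerivAt p hx
    have hinv := (hasDerivAt_inv hp).comp_hasFDerivAt p ((hx.const_mul ε).const_sub 1)
    simp only [div_eq_mul_inv _ (1 - ε * Prod.fst _)]
    refine ((hP.sub hy).mul hinv).congr_fderiv ?_
    ext <;> simp [a, b, yb] <;> field_simp
    ring
  have hPyb := (hasDerivAt_cubicP d M₁ M₂ yb).comp_hasFDerivAt p hyb
  refine HasFDerivAt.prodMk (((hPyb.sub hx).add ((hx.const_mul ε).mul hyb)).congr_fderiv ?_) hyb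
  ext <;> simp [k, ← show yb = (cubicP d M₁ M₂ p.1 - p.2) / (1 - ε * p.1) from rfl] <;> ring

/-- at every point with `1 - εx ≠ 0`, the perturbed map is
differentiable and the determinant of its Jacobian matrix equals
`(1 - εȳ)/(1 - εx)` where `ȳ = (P(x) - y)/(1 - εx)`; in particular for
`ε ≠ 0` this determinant is not identically `1`, so the map is
non-conservative. -/
theorem perturbedH2_jacobian (d M₁ M₂ ε : ℝ) (hd : d = -1 ∨ d = 1) :
    (∀ p : ℝ × ℝ, 1 - ε * p.1 ≠ 0 →
      DifferentiableAt ℝ (perturbedH2 d M₁ M₂ ε) p ∧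
      LinearMap.det (↑(fderiv ℝ (perturbedH2 d M₁ M₂ ε) p) : (ℝ × ℝ) →ₗ[ℝ] ℝ × ℝ) =
        (1 - ε * ((cubicP d M₁ M₂ p.1 - p.2) / (1 - ε * p.1))) / (1 - ε * p.1)) ∧
    (ε ≠ 0 → ∃ p : ℝ × ℝ, 1 - ε * p.1 ≠ 0 ∧
      LinearMap.det (↑(fderiv ℝ (perturbedH2 d M₁ M₂ ε) p) : (ℝ × ℝ) →ₗ[ℝ] ℝ × ℝ) ≠ 1) := by
  have hdet : ∀ p : ℝ × ℝ, 1 - ε * p.1 ≠ 0 →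
      LinearMap.det (↑(fderiv ℝ (perturbedH2 d M₁ M₂ ε) p) : (ℝ × ℝ) →ₗ[ℝ] ℝ × ℝ) =
        (1 - ε * ((cubicP d M₁ M₂ p.1 - p.2) / (1 - ε * p.1))) / (1 - ε * p.1) := by
    intro p hp
    rw [(hasFDerivAt_perturbedH2 d M₁ M₂ ε p hp).fderiv, det_prod_smul_fst_add_smul_snd]
    ring
  refine ⟨fun p hp => ⟨(hasFDerivAt_perturbedH2 d M₁ M₂ ε p hp).differentiableAt, hdet p hp⟩,
    fun hε => ⟨(0, M₁ - 1), by simp, ?_⟩⟩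
  rw [hdet _ (by simp)]
  simpa [cubicP] using hε
end

section
/- Fix d ∈ {−1, 1}, M₁, M₂, ε ∈ ℝ, and let P(t) = M₁ + M₂ t + d t³. Define the map f by f(x,y) = (x̄, ȳ), where ȳ = −x + P(y·(1 + εx)) and x̄ = y·(1 + εx)/(1 + εȳ), on the set where 1 + εȳ ≠ 0. Then f is reversible with respect to h(x,y) = (y,x) in the following sense: if (x̄, ȳ) = f(x,y) with 1 + εȳ ≠ 0, and additionally 1 + εx ≠ 0, then f(ȳ, x̄) = (y, x). -/
/-- The explicit form of the reversible non-conservative perturbation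
`H̃₃^d(ε)` of the cubic Hénon map: `f(x,y) = (x̄, ȳ)` with
`ȳ = -x + P(y(1 + εx))` and `x̄ = y(1 + εx)/(1 + εȳ)`. -/
noncomputable def perturbedH3 (d M₁ M₂ ε : ℝ) : ℝ × ℝ → ℝ × ℝ := fun p =>
  let yb := -p.1 + cubicP d M₁ M₂ (p.2 * (1 + ε * p.1))
  (p.2 * (1 + ε * p.1) / (1 + ε * yb), yb)

/-- reversibility of the perturbed map with respect to
`h(x,y) = (y,x)`: if `(x̄,ȳ) = f(x,y)` with `1 + εȳ ≠ 0` and additionally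
`1 + εx ≠ 0`, then `f(ȳ,x̄) = (y,x)`. -/
theorem perturbedH3_reversible (d M₁ M₂ ε x y : ℝ) (hd : d = -1 ∨ d = 1)
    (hyb : 1 + ε * (-x + cubicP d M₁ M₂ (y * (1 + ε * x))) ≠ 0)
    (hx : 1 + ε * x ≠ 0) :
    perturbedH3 d M₁ M₂ ε (swapInvolution (perturbedH3 d M₁ M₂ ε (x, y))) = (y, x) := by
  simp only [perturbedH3, swapInvolution]
  rw [div_mul_cancel₀ _ hyb, neg_add, neg_neg, neg_add_cancel_right, mul_div_cancel_right₀ _ hx]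
end

section
/- (1:3 resonance curve.) Fix d ∈ {−1, 1} and M₂ ∈ ℝ, and suppose y ∈ ℝ satisfies 3 d y² = −(1 + M₂). Set M₁ = (7 − 2M₂)·y/3. Then (y, y) is a fixed point of the cubic Hénon map H₃^d(x,y) = (y, −x + M₁ + M₂y + d y³), and the Jacobian matrix of H₃^d at (y,y) has trace −1 and determinant 1; hence its eigenvalues are e^{±2πi/3}. Moreover the parameters satisfy M₁² = −(d/27)(1 + M₂)(2M₂ − 7)². -/
open Polynomial in
/-- The cubic Hénon map `H₃^d(x,y) = (y, -x + M₁ + M₂·y + d·y³)`. -/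
def henonCubic (d M₁ M₂ : ℝ) : ℝ × ℝ → ℝ × ℝ :=
  fun p => (p.2, -p.1 + M₁ + M₂ * p.2 + d * p.2 ^ 3)

theorem Complex.exp_two_pi_mul_I_div_three_add_exp_neg :
    Complex.exp (2 * Real.pi * Complex.I / 3) + Complex.exp (-(2 * Real.pi * Complex.I) / 3) =
      -1 := by
  have hw : IsPrimitiveRoot (Complex.exp (2 * Real.pi * Complex.I / 3)) 3 := by
    exact_mod_cast Complex.isPrimitiveRoot_exp 3 (by norm_num)
  have hsum := hw.geom_sum_eq_zero (by norm_num)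
  simp only [Finset.sum_range_succ, Finset.sum_range_zero] at hsum
  have h0 := Complex.exp_ne_zero (2 * Real.pi * Complex.I / 3)
  rw [neg_div, Complex.exp_neg]
  field_simp
  linear_combination hsum

/-- 1:3 resonance curve: if `3dy² = -(1 + M₂)` and
`M₁ = (7 - 2M₂)y/3`, then `(y,y)` is a fixed point of `H₃^d`, the Jacobian
matrix of `H₃^d` at `(y,y)` (the matrix with rows `(0,1)` and
`(-1, M₂ + 3dy²)`) has trace `-1` and determinant `1`, hence its eigenvalues
are `e^{±2πi/3}`; moreover `M₁² = -(d/27)(1 + M₂)(2M₂ - 7)²`. -/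
theorem henonCubic_one_three_resonance (d M₂ y : ℝ) (hd : d = -1 ∨ d = 1)
    (hy : 3 * d * y ^ 2 = -(1 + M₂)) :
    let M₁ : ℝ := (7 - 2 * M₂) * y / 3
    let A : Matrix (Fin 2) (Fin 2) ℝ := !![0, 1; -1, M₂ + 3 * d * y ^ 2]
    henonCubic d M₁ M₂ (y, y) = (y, y) ∧
    Matrix.trace A = -1 ∧
    A.det = 1 ∧
    (∀ z : ℂ, (A.map (Complex.ofReal)).charpoly.IsRoot z ↔
      z = Complex.exp (2 * Real.pi * Complex.I / 3) ∨
      z = Complex.exp (-(2 * Real.pi * Complex.I) / 3)) ∧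
    M₁ ^ 2 = -(d / 27) * (1 + M₂) * (2 * M₂ - 7) ^ 2 := by
  intro M₁ A
  have htr : M₂ + 3 * d * y ^ 2 = -1 := by linear_combination hy
  have hd2 : d ^ 2 = 1 := by rcases hd with rfl | rfl <;> norm_num
  have hA : A = !![0, 1; -1, -1] := by simp only [A, htr]
  refine ⟨?_, ?_, ?_, fun z => ?_, ?_⟩
  · simp only [henonCubic, M₁, Prod.mk.injEq, true_and]
    linear_combination y / 3 * hy
  · simp [hA, Matrix.trace_fin_two]
  · simp [hA, Matrix.det_fin_two]
  · have hroot : (A.map Complex.ofReal).charpoly.IsRoot z ↔ z ^ 2 + z + 1 = 0 := by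
      simp [hA, Matrix.charpoly_fin_two, Matrix.trace_fin_two, Matrix.det_fin_two]
    have hmul : Complex.exp (2 * Real.pi * Complex.I / 3) *
        Complex.exp (-(2 * Real.pi * Complex.I) / 3) = 1 := by
      rw [← Complex.exp_add, neg_div, add_neg_cancel, Complex.exp_zero]
    have hfactor : z ^ 2 + z + 1 = (z - Complex.exp (2 * Real.pi * Complex.I / 3)) *
        (z - Complex.exp (-(2 * Real.pi * Complex.I) / 3)) := by
      linear_combination z * Complex.exp_two_pi_mul_I_div_three_add_exp_neg - hmul
    rw [hroot, hfactor, mul_eq_zero, sub_eq_zero, sub_eq_zero]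
  · simp only [M₁]
    linear_combination (7 - 2 * M₂) ^ 2 / 27 * d * hy - (7 - 2 * M₂) ^ 2 / 9 * y ^ 2 * hd2
end
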